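/- arXiv:2201.04907 — 2 statements merged into one kernel-verified Lean document; each statement's English description precedes it below -/
import Mathlib

section
/- Let N ≥ 2 and s ∈ (0,1), and let ψ(t) = t^(1+2s) ∫_0^1 (h(1-h))^((N-3)/2)/(t²+h)^((N+2s)/2) dh for t ∈ (0,1], with ψ(0) = Γ(1/2+s)Γ((N-1)/2)/Γ((N+2s)/2). Then there exist δ > 0 and C > 0 such that |ψ(t) - ψ(t')| ≤ C|t - t'|^(s+δ) for all t, t' ∈ [0,1]; that is, ψ ∈ C^(s+δ)([0,1]). -/
open MeasureTheory Real

lemma beta_int (p q : ℝ) (hp : 0 < p) (hq : 0 < q) :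
    IntegrableOn (fun x : ℝ => x ^ (p-1) * (1-x)^(q-1)) (Set.Ioo 0 1) ∧
    ∫ x in Set.Ioo (0:ℝ) 1, x ^ (p-1) * (1-x)^(q-1) = Gamma p * Gamma q / Gamma (p+q) := by
  have h1 := Complex.betaIntegral_convergent (u := p) (v := q) (by simpa) (by simpa)
  rw [intervalIntegrable_iff_integrableOn_Ioo_of_le zero_le_one] at h1
  have e : Set.EqOn (fun x : ℝ => (x:ℂ) ^ ((p:ℂ)-1) * (1-(x:ℂ))^((q:ℂ)-1))
      (fun x : ℝ => ((x ^ (p-1) * (1-x)^(q-1) : ℝ) : ℂ)) (Set.Ioo 0 1) := by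
    intro x hx
    simp only
    rw [Complex.ofReal_mul, Complex.ofReal_cpow hx.1.le, Complex.ofReal_cpow (by linarith [hx.2])]
    simp
  have h2 := h1.congr_fun e measurableSet_Ioo
  refine ⟨?_, ?_⟩
  · have := h2.re
    rw [IntegrableOn]; simpa using this
  · have h3 := ProbabilityTheory.beta_eq_betaIntegralReal p q hp hq
    rw [ProbabilityTheory.beta] at h3
    rw [h3, Complex.betaIntegral, intervalIntegral.integral_of_le zero_le_one,
      integral_Ioc_eq_integral_Ioo, setIntegral_congr_fun measurableSet_Ioo e, integral_complex_ofReal,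
      Complex.ofReal_re]

lemma pw_bound (T v e : ℝ) (hT0 : 0 ≤ T) (hT : T ≤ 1) (hv : 0 < v) (hv1 : v < 1) (he : e ≤ 1) :
    (T+v)^e ≤ v^e + 2 := by
  have h0 : 0 ≤ v^e := rpow_nonneg hv.le _
  rcases le_or_gt e 0 with h | h
  · have := rpow_le_rpow_of_nonpos hv (show v ≤ T+v by linarith) h
    linarith
  · have h1 : (T+v)^e ≤ 2^e := rpow_le_rpow (by linarith) (by linarith) h.le
    have h2 : (2:ℝ)^e ≤ 2^(1:ℝ) := rpow_le_rpow_of_exponent_le (by norm_num) he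
    rw [rpow_one] at h2
    linarith

lemma pw_lip (v k e : ℝ) (hv : 0 < v) (he : e = k - 1/2) (K : ℝ)
    (hK : ∀ t ∈ Set.Icc (0:ℝ) 1, (t^2+v)^e ≤ K) (t : ℝ) (ht : t ∈ Set.Icc (0:ℝ) 1)
    (t' : ℝ) (ht' : t' ∈ Set.Icc (0:ℝ) 1) :
    |(t^2+v)^k - (t'^2+v)^k| ≤ 2 * |k| * K * |t - t'| := by
  have := Convex.norm_image_sub_le_of_norm_hasDerivWithin_le (𝕜 := ℝ) (s := Set.Icc (0:ℝ) 1)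
    (f := fun t : ℝ => (t^2+v)^k) (f' := fun t => (2*t) * k * (t^2+v)^(k-1)) (C := 2 * |k| * K)
    (x := t') (y := t) ?_ ?_ (convex_Icc 0 1) ht' ht
  · simpa [Real.norm_eq_abs] using this
  · intro x hx
    have h1 : HasDerivAt (fun t : ℝ => t^2+v) (2*x) x := by
      simpa using (hasDerivAt_pow 2 x).add_const v
    exact (h1.rpow_const (Or.inl (by positivity))).hasDerivWithinAt
  · intro x hx
    have hp : 0 < x^2+v := by positivity
    have h2 : x ≤ (x^2+v)^(1/2:ℝ) := by
      rw [← Real.sqrt_eq_rpow]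
      exact Real.le_sqrt_of_sq_le (by linarith)
    have h3 : x * (x^2+v)^(k-1) ≤ K := by
      refine le_trans ?_ (hK x hx)
      calc _ ≤ (x^2+v)^(1/2:ℝ) * (x^2+v)^(k-1) := by gcongr
        _ = (x^2+v)^e := by rw [← rpow_add hp, he]; congr 1; ring
    have h4 : 0 ≤ (x^2+v)^(k-1) := by positivity
    rw [Real.norm_eq_abs, abs_mul, abs_mul, abs_of_nonneg h4, abs_of_nonneg (by linarith [hx.1] : 0 ≤ 2*x)]
    calc _ = 2 * |k| * (x * (x^2+v)^(k-1)) := by ring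
      _ ≤ _ := by gcongr

lemma cov (a c T : ℝ) (hT : 0 < T) :
    T^c * ∫ h in Set.Ioo (0:ℝ) 1, (h*(1-h))^(a-1) / (T+h)^(a+c) =
    (T+1)^(-c) * ∫ v in Set.Ioo (0:ℝ) 1, (v*(1-v))^(a-1) * (T+v)^(c-a) := by
  set φ : ℝ → ℝ := fun v => T*(1-v)/(T+v) with hφ
  have hmap : ∀ v ∈ Set.Ioo (0:ℝ) 1, φ v ∈ Set.Ioo (0:ℝ) 1 := by
    intro v hv
    have h0 : 0 < T + v := by linarith [hv.1]
    refine ⟨div_pos (mul_pos hT (by linarith [hv.2])) h0, ?_⟩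
    rw [hφ]; simp only
    rw [div_lt_one h0]
    nlinarith [mul_pos hT hv.1, hv.1]
  have hinv : ∀ v ∈ Set.Ioo (0:ℝ) 1, φ (φ v) = v := by
    intro v hv
    have h0 : 0 < T + v := by linarith [hv.1]
    have h1 : 0 < T + φ v := by linarith [(hmap v hv).1]
    rw [show φ (φ v) = T*(1-φ v)/(T+φ v) from rfl, div_eq_iff h1.ne']
    simp only [hφ]
    field_simp
    ring
  have him : φ '' Set.Ioo 0 1 = Set.Ioo 0 1 := by
    apply Set.Subset.antisymm
    · rintro _ ⟨v, hv, rfl⟩; exact hmap v hv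
    · intro v hv; exact ⟨φ v, hmap v hv, hinv v hv⟩
  have hder : ∀ x ∈ Set.Ioo (0:ℝ) 1, HasDerivWithinAt φ (-(T*(T+1)/(T+x)^2)) (Set.Ioo 0 1) x := by
    intro x hx
    have h0 : T + x ≠ 0 := by linarith [hx.1]
    have h1 : HasDerivAt (fun v : ℝ => T*(1-v)) (-T) x := by
      simpa using ((hasDerivAt_id x).const_sub 1).const_mul T
    have h2 : HasDerivAt (fun v : ℝ => T+v) 1 x := by
      simpa using (hasDerivAt_id x).const_add T
    have h3 : HasDerivAt φ _ x := h1.div h2 h0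
    refine (h3.congr_deriv ?_).hasDerivWithinAt
    field_simp
    ring
  have hinj : Set.InjOn φ (Set.Ioo 0 1) := by
    intro x hx y hy h
    rw [← hinv x hx, ← hinv y hy, h]
  have := integral_image_eq_integral_abs_deriv_smul measurableSet_Ioo hder hinj
    (fun h => (h*(1-h))^(a-1) / (T+h)^(a+c))
  rw [him] at this
  rw [this, ← integral_const_mul, ← integral_const_mul]
  apply setIntegral_congr_fun measurableSet_Ioo
  intro v hv
  have hD : 0 < T + v := by linarith [hv.1]
  have hP : 0 < T + 1 := by linarith
  have hv0 := hv.1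
  have hv1 : 0 < 1 - v := by linarith [hv.2]
  have e1 : φ v * (1 - φ v) = (T*(T+1)/(T+v)) * ((v*(1-v))/(T+v)) := by
    simp only [hφ]; field_simp; ring
  have e2 : T + φ v = T*(T+1)/(T+v) := by
    simp only [hφ]; field_simp; ring
  have hR : 0 < T*(T+1)/(T+v) := by positivity
  simp only [smul_eq_mul]
  rw [abs_neg, abs_of_pos (by positivity), e1, e2, mul_rpow hR.le (by positivity),
    div_rpow (by positivity : 0 ≤ v*(1-v)) hD.le]
  have e3 : T*(T+1)/(T+v)^2 = (T*(T+1)/(T+v)) / (T+v) := by field_simp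
  rw [e3]
  have e4 : (T*(T+1)/(T+v))^(a+c) = (T*(T+1)/(T+v))^(a-1) * (T*(T+1)/(T+v)) * (T^c * (T+1)^c / (T+v)^c) := by
    rw [← mul_rpow hT.le hP.le, ← div_rpow (by positivity) hD.le, ← rpow_add_one hR.ne', ← rpow_add hR]
    congr 1; ring
  rw [e4, rpow_neg hP.le, rpow_sub_one hD.ne' a, rpow_sub hD]
  have p1 : 0 < (T*(T+1)/(T+v))^(a-1) := by positivity
  have p2 : 0 < T^c := by positivity
  have p3 : 0 < (T+1)^c := by positivity
  have p4 : 0 < (T+v)^c := by positivity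
  have p5 : 0 < (T+v)^a := by positivity
  generalize (T*(T+1)/(T+v))^(a-1) = A at *
  generalize (T*(T+1)/(T+v)) = R at *
  field_simp

lemma wt_int (a e : ℝ) (ha : 0 < a) (hea : 0 < e + a) :
    IntegrableOn (fun v : ℝ => (v*(1-v))^(a-1) * (v^e + 2)) (Set.Ioo 0 1) := by
  have h1 := (beta_int (e+a) a hea ha).1
  have h2 := ((beta_int a a ha ha).1).const_mul 2
  refine (h1.add h2).congr_fun ?_ measurableSet_Ioo
  intro v hv
  have hv0 := hv.1
  have hv1 : 0 < 1 - v := by linarith [hv.2]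
  simp only [Pi.add_apply]
  rw [mul_rpow hv0.le hv1.le, show e + a - 1 = (a-1) + e by ring, rpow_add hv0]
  ring

lemma main_aux (a c s : ℝ) (ha : 1/2 ≤ a) (hs0 : 0 < s) (hs1 : s < 1) (hc : c = 1/2 + s) :
    ∃ C > 0, ∀ t ∈ Set.Icc (0:ℝ) 1, ∀ t' ∈ Set.Icc (0:ℝ) 1,
     |(t^2+1)^(-c) * (∫ v in Set.Ioo (0:ℝ) 1, (v*(1-v))^(a-1) * (t^2+v)^(c-a)) -
      (t'^2+1)^(-c) * (∫ v in Set.Ioo (0:ℝ) 1, (v*(1-v))^(a-1) * (t'^2+v)^(c-a))| ≤ C * |t - t'| := by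
  set F : ℝ → ℝ := fun t => ∫ v in Set.Ioo (0:ℝ) 1, (v*(1-v))^(a-1) * (t^2+v)^(c-a) with hF
  have ha0 : 0 < a := by linarith
  have i1 := wt_int a (c-a) ha0 (by linarith)
  have i2 := wt_int a (s-a) ha0 (by linarith)
  set M1 := ∫ v in Set.Ioo (0:ℝ) 1, (v*(1-v))^(a-1) * (v^(c-a) + 2) with hM1
  set M2 := ∫ v in Set.Ioo (0:ℝ) 1, (v*(1-v))^(a-1) * (v^(s-a) + 2) with hM2
  have sq1 : ∀ t ∈ Set.Icc (0:ℝ) 1, t^2 ≤ 1 := fun t ht => pow_le_one₀ ht.1 ht.2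
  have wpos : ∀ v ∈ Set.Ioo (0:ℝ) 1, 0 ≤ (v*(1-v))^(a-1) := fun v hv =>
    rpow_nonneg (mul_nonneg hv.1.le (by linarith [hv.2])) _
  have pb : ∀ t ∈ Set.Icc (0:ℝ) 1, ∀ v ∈ Set.Ioo (0:ℝ) 1,
      ‖(v*(1-v))^(a-1) * (t^2+v)^(c-a)‖ ≤ (v*(1-v))^(a-1) * (v^(c-a) + 2) := by
    intro t ht v hv
    have h := pw_bound (t^2) v (c-a) (sq_nonneg t) (sq1 t ht) hv.1 hv.2 (by linarith)
    have h0 : 0 ≤ (t^2+v)^(c-a) := rpow_nonneg (by linarith [sq_nonneg t, hv.1]) _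
    rw [Real.norm_of_nonneg (mul_nonneg (wpos v hv) h0)]
    exact mul_le_mul_of_nonneg_left h (wpos v hv)
  have fi : ∀ t ∈ Set.Icc (0:ℝ) 1,
      IntegrableOn (fun v : ℝ => (v*(1-v))^(a-1) * (t^2+v)^(c-a)) (Set.Ioo 0 1) := by
    intro t ht
    refine Integrable.mono' i1 (Measurable.aestronglyMeasurable (by fun_prop)) ?_
    exact ae_restrict_of_forall_mem measurableSet_Ioo (pb t ht)
  have Fb : ∀ t ∈ Set.Icc (0:ℝ) 1, |F t| ≤ M1 := by
    intro t ht
    rw [← Real.norm_eq_abs]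
    exact norm_integral_le_of_norm_le i1 (ae_restrict_of_forall_mem measurableSet_Ioo (pb t ht))
  have M1n : 0 ≤ M1 := le_trans (abs_nonneg _) (Fb 0 (by simp))
  have M2n : 0 ≤ M2 := setIntegral_nonneg measurableSet_Ioo fun v hv =>
    mul_nonneg (wpos v hv) (by have := rpow_nonneg hv.1.le (s-a); linarith)
  have FL : ∀ t ∈ Set.Icc (0:ℝ) 1, ∀ t' ∈ Set.Icc (0:ℝ) 1,
      |F t - F t'| ≤ (2 * |c-a| * |t - t'|) * M2 := by
    intro t ht t' ht'
    simp only [hF]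
    rw [← integral_sub (fi t ht) (fi t' ht'), hM2, ← integral_const_mul]
    rw [← Real.norm_eq_abs]
    refine norm_integral_le_of_norm_le (i2.const_mul _)
      (ae_restrict_of_forall_mem measurableSet_Ioo fun v hv => ?_)
    have h := pw_lip v (c-a) (s-a) hv.1 (by rw [hc]; ring) (v^(s-a)+2)
      (fun t ht => pw_bound (t^2) v (s-a) (sq_nonneg t) (sq1 t ht) hv.1 hv.2 (by linarith))
      t ht t' ht'
    rw [← mul_sub, norm_mul, Real.norm_of_nonneg (wpos v hv), Real.norm_eq_abs]
    calc _ ≤ (v*(1-v))^(a-1) * (2 * |c-a| * (v^(s-a)+2) * |t - t'|) :=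
          mul_le_mul_of_nonneg_left h (wpos v hv)
      _ = _ := by ring
  have uL : ∀ t ∈ Set.Icc (0:ℝ) 1, ∀ t' ∈ Set.Icc (0:ℝ) 1,
      |(t^2+1)^(-c) - (t'^2+1)^(-c)| ≤ 2 * |-c| * 1 * |t - t'| := by
    intro t ht t' ht'
    refine pw_lip 1 (-c) (-c-1/2) one_pos rfl 1 (fun t ht => ?_) t ht t' ht'
    exact rpow_le_one_of_one_le_of_nonpos (by linarith [sq_nonneg t]) (by linarith)
  have ub : ∀ t : ℝ, |(t^2+1)^(-c)| ≤ 1 := by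
    intro t
    rw [abs_of_nonneg (by positivity)]
    exact rpow_le_one_of_one_le_of_nonpos (by linarith [sq_nonneg t]) (by linarith)
  refine ⟨2 * |-c| * 1 * M1 + 2 * |c-a| * M2 + 1, by positivity, ?_⟩
  intro t ht t' ht'
  have e : (t^2+1)^(-c) * F t - (t'^2+1)^(-c) * F t' =
      ((t^2+1)^(-c) - (t'^2+1)^(-c)) * F t + (t'^2+1)^(-c) * (F t - F t') := by ring
  change |(t^2+1)^(-c) * F t - (t'^2+1)^(-c) * F t'| ≤ _
  rw [e]
  calc _ ≤ |(t^2+1)^(-c) - (t'^2+1)^(-c)| * |F t| + |(t'^2+1)^(-c)| * |F t - F t'| := by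
        rw [← abs_mul, ← abs_mul]; exact abs_add_le _ _
    _ ≤ (2 * |-c| * 1 * |t - t'|) * M1 + 1 * ((2 * |c-a| * |t - t'|) * M2) := by
        gcongr
        · exact uL t ht t' ht'
        · exact Fb t ht
        · exact ub t'
        · exact FL t ht t' ht'
    _ ≤ _ := by nlinarith [abs_nonneg (t - t')]

lemma psi_eq (N : ℕ) (hN : 2 ≤ N) (s : ℝ) (hs : 0 < s) (t : ℝ) (ht : 0 ≤ t) :
    (if t = 0 then
          Real.Gamma (1/2+s) * Real.Gamma (((N:ℝ)-1)/2) / Real.Gamma (((N:ℝ)+2*s)/2)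
        else t ^ (1 + 2*s) *
          ∫ h in Set.Ioo (0:ℝ) 1,
            (h*(1-h)) ^ (((N:ℝ)-3)/2) / (t^2 + h) ^ (((N:ℝ)+2*s)/2)) =
    (t^2+1)^(-(1/2+s)) *
      ∫ v in Set.Ioo (0:ℝ) 1, (v*(1-v))^(((N:ℝ)-1)/2-1) * (t^2+v)^((1/2+s)-((N:ℝ)-1)/2) := by
  have hN' : (2:ℝ) ≤ N := by exact_mod_cast hN
  split_ifs with h
  · subst h
    have hb := (beta_int (1/2+s) (((N:ℝ)-1)/2) (by linarith) (by linarith)).2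
    rw [show ((N:ℝ)+2*s)/2 = (1/2+s) + ((N:ℝ)-1)/2 by ring, ← hb]
    norm_num only [zero_add, one_rpow, one_mul, ne_eq, zero_pow, OfNat.ofNat_ne_zero, not_false_eq_true]
    apply setIntegral_congr_fun measurableSet_Ioo
    intro v hv
    have hv0 := hv.1
    have hv1 : 0 < 1 - v := by linarith [hv.2]
    simp only
    rw [mul_rpow hv0.le hv1.le, mul_right_comm, ← rpow_add hv0]
    congr 2
    ring
  · have h0 : 0 < t := lt_of_le_of_ne ht (Ne.symm h)
    rw [← cov _ _ _ (by positivity : 0 < t^2)]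
    rw [show ((N:ℝ)+2*s)/2 = ((N:ℝ)-1)/2 + (1/2+s) by ring,
      show ((N:ℝ)-3)/2 = ((N:ℝ)-1)/2-1 by ring,
      show (1 + 2*s) = ((2:ℕ):ℝ) * (1/2+s) by push_cast; ring, rpow_mul h0.le, rpow_natCast]

theorem stmt5 (N : ℕ) (hN : 2 ≤ N) (s : ℝ) (hs : s ∈ Set.Ioo (0:ℝ) 1) :
    ∃ δ > 0, ∃ C > 0, ∀ t ∈ Set.Icc (0:ℝ) 1, ∀ t' ∈ Set.Icc (0:ℝ) 1,
      |(if t = 0 then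
          Real.Gamma (1/2+s) * Real.Gamma (((N:ℝ)-1)/2) / Real.Gamma (((N:ℝ)+2*s)/2)
        else t ^ (1 + 2*s) *
          ∫ h in Set.Ioo (0:ℝ) 1,
            (h*(1-h)) ^ (((N:ℝ)-3)/2) / (t^2 + h) ^ (((N:ℝ)+2*s)/2)) -
       (if t' = 0 then
          Real.Gamma (1/2+s) * Real.Gamma (((N:ℝ)-1)/2) / Real.Gamma (((N:ℝ)+2*s)/2)
        else t' ^ (1 + 2*s) *
          ∫ h in Set.Ioo (0:ℝ) 1,
            (h*(1-h)) ^ (((N:ℝ)-3)/2) / (t'^2 + h) ^ (((N:ℝ)+2*s)/2))| ≤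
      C * |t - t'| ^ (s + δ) := by
  have hN' : (2:ℝ) ≤ N := by exact_mod_cast hN
  obtain ⟨C, hC, H⟩ := main_aux (((N:ℝ)-1)/2) (1/2+s) s (by linarith) hs.1 hs.2 rfl
  refine ⟨1 - s, by linarith [hs.2], C, hC, ?_⟩
  intro t ht t' ht'
  rw [psi_eq N hN s hs.1 t ht.1, psi_eq N hN s hs.1 t' ht'.1, add_sub_cancel, rpow_one]
  exact H t ht t' ht'
end

section
/- Let N ≥ 2, s ∈ (0,1), and R > 1. For r ∈ (0,1), write the tail integral T_R(r) = ∫_{(-R,∞)\(-2,2)} K_R(r, r̃)/|r-r̃|^{1+2s} dr̃ where K_R(r, r̃) = ((r+R)(r̃+R))^{(N-1)/2} R^{-(N-1)} ∫_{ρ(S^{N-1}-e₁)} (1+|θ|²)^{-(N+2s)/2} dθ with ρ = √((r+R)(r̃+R))/|r-r̃|. Then there exists C(N,s) > 0 and R₀ > 1 such that T_R(r) ≤ C(N,s) for all r ∈ (0,1) and all R ≥ R₀. -/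
open MeasureTheory Real

/-- The kernel `K_R(r, r̃)` arising from the fractional Dirichlet form on the annulus
`A_R` in polar coordinates. -/
noncomputable def KR (N : ℕ) (hN : 2 ≤ N) (s R r r' : ℝ) : ℝ :=
  ((r + R) * (r' + R)) ^ (((N:ℝ)-1)/2) * R ^ (-((N:ℝ)-1)) *
    ∫ θ in Metric.sphere
        (-((Real.sqrt ((r + R) * (r' + R)) / |r - r'|) •
          EuclideanSpace.single (⟨0, by omega⟩ : Fin N) (1:ℝ)))
        (Real.sqrt ((r + R) * (r' + R)) / |r - r'|),
      (1 + ‖θ‖^2) ^ (-((N:ℝ)+2*s)/2) ∂(μH[(N:ℝ)-1])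

open scoped NNReal ENNReal

/-- A patch of the sphere is a bi-Lipschitz graph. -/
lemma patch_dist (n : ℕ) (c : EuclideanSpace ℝ (Fin (n+1))) (ρ : ℝ) (hρ : 0 < ρ)
    (i : Fin (n+1)) (ε : ℝ) (hε : ε = 1 ∨ ε = -1)
    (x y : EuclideanSpace ℝ (Fin (n+1))) (hx : dist x c = ρ) (hy : dist y c = ρ)
    (hxi : ρ ≤ (n+1) * (ε * (x i - c i))) (hyi : ρ ≤ (n+1) * (ε * (y i - c i)))
    (δ : ℝ) (hδ : ∀ j : Fin n, |x (i.succAbove j) - y (i.succAbove j)| ≤ δ) (hδ0 : 0 ≤ δ) :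
    dist x y ≤ ((n:ℝ)+1)^3 * δ := by
  have key : ∀ z : EuclideanSpace ℝ (Fin (n+1)), dist z c = ρ →
      (z i - c i)^2 + ∑ j : Fin n, (z (i.succAbove j) - c (i.succAbove j))^2 = ρ^2 := by
    intro z hz
    rw [← hz, EuclideanSpace.dist_eq, Real.sq_sqrt (by positivity), Fin.sum_univ_succAbove _ i]
    simp [Real.dist_eq, sq_abs]
  have kx := key x hx
  have ky := key y hy
  have bd : ∀ z : EuclideanSpace ℝ (Fin (n+1)), dist z c = ρ → ∀ j, |z j - c j| ≤ ρ := by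
    intro z hz j
    rw [← hz, dist_eq_norm]
    simpa using PiLp.norm_apply_le (z - c) j
  have h1 : (x i - y i) * ((x i - c i) + (y i - c i)) =
      ∑ j : Fin n, (y (i.succAbove j) - x (i.succAbove j)) *
        ((x (i.succAbove j) - c (i.succAbove j)) + (y (i.succAbove j) - c (i.succAbove j))) := by
    have : ∑ j : Fin n, (y (i.succAbove j) - x (i.succAbove j)) *
        ((x (i.succAbove j) - c (i.succAbove j)) + (y (i.succAbove j) - c (i.succAbove j)))
        = ∑ j : Fin n, (y (i.succAbove j) - c (i.succAbove j))^2
          - ∑ j : Fin n, (x (i.succAbove j) - c (i.succAbove j))^2 := by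
      rw [← Finset.sum_sub_distrib]
      exact Finset.sum_congr rfl (fun j _ => by ring)
    rw [this]
    linarith
  have h2 : |x i - y i| * |(x i - c i) + (y i - c i)| ≤ n * (δ * (2 * ρ)) := by
    rw [← abs_mul, h1]
    refine (Finset.abs_sum_le_sum_abs _ _).trans ?_
    have : ∀ j ∈ (Finset.univ : Finset (Fin n)), |(y (i.succAbove j) - x (i.succAbove j)) *
        ((x (i.succAbove j) - c (i.succAbove j)) + (y (i.succAbove j) - c (i.succAbove j)))|
        ≤ δ * (2 * ρ) := by
      intro j _
      rw [abs_mul]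
      have e1 := hδ j
      rw [abs_sub_comm] at e1
      have e2 := (abs_add_le (x (i.succAbove j) - c (i.succAbove j))
        (y (i.succAbove j) - c (i.succAbove j)))
      have e3 := bd x hx (i.succAbove j)
      have e4 := bd y hy (i.succAbove j)
      exact mul_le_mul e1 (by linarith) (abs_nonneg _) hδ0
    refine (Finset.sum_le_sum this).trans ?_
    simp
  have h3 : 2 * ρ ≤ (n+1) * |(x i - c i) + (y i - c i)| := by
    have e : ε * ((x i - c i) + (y i - c i)) ≤ |(x i - c i) + (y i - c i)| := by
      rcases hε with h | h
      · rw [h, one_mul]; exact le_abs_self _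
      · rw [h, neg_one_mul]; exact neg_le_abs _
    have := mul_le_mul_of_nonneg_left e (by positivity : (0:ℝ) ≤ n+1)
    linarith
  have h4 : |x i - y i| ≤ ((n:ℝ)+1)^2 * δ := by
    have e1 := mul_le_mul_of_nonneg_left h3 (abs_nonneg (x i - y i))
    have e2 := mul_le_mul_of_nonneg_left h2 (by positivity : (0:ℝ) ≤ n+1)
    have e3 : |x i - y i| * (2 * ρ) ≤ ((n+1) * n * δ) * (2 * ρ) := by linarith
    have e4 := le_of_mul_le_mul_right e3 (by positivity)
    refine e4.trans (mul_le_mul_of_nonneg_right ?_ hδ0)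
    nlinarith [(Nat.cast_nonneg n : (0:ℝ) ≤ n)]
  have h5 : ∀ j, |x j - y j| ≤ ((n:ℝ)+1)^2 * δ := by
    intro j
    rcases Fin.eq_self_or_eq_succAbove i j with h | ⟨k, h⟩
    · rw [h]; exact h4
    · rw [h]
      refine (hδ k).trans (le_mul_of_one_le_left hδ0 ?_)
      nlinarith [(Nat.cast_nonneg n : (0:ℝ) ≤ n)]
  rw [EuclideanSpace.dist_eq]
  apply Real.sqrt_le_iff.2 ⟨by positivity, ?_⟩
  have h6 : ∀ j ∈ (Finset.univ : Finset (Fin (n+1))), dist (x j) (y j) ^ 2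
      ≤ (((n:ℝ)+1)^2 * δ)^2 := by
    intro j _
    rw [Real.dist_eq]
    exact pow_le_pow_left₀ (abs_nonneg _) (h5 j) 2
  refine (Finset.sum_le_sum h6).trans ?_
  simp only [Finset.sum_const, Finset.card_univ, Fintype.card_fin, nsmul_eq_mul]
  push_cast
  have : (((n:ℝ)+1)^3 * δ)^2 = ((n:ℝ)+1) * ((((n:ℝ)+1)^2 * δ)^2) * ((n:ℝ)+1) := by ring
  rw [this]
  exact le_mul_of_one_le_right (by positivity) (by linarith [(Nat.cast_nonneg n : (0:ℝ) ≤ n)])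

/-- Measure bound for one patch. -/
lemma patch_measure (n : ℕ) (c : EuclideanSpace ℝ (Fin (n+1))) (ρ : ℝ) (hρ : 0 < ρ)
    (i : Fin (n+1)) (ε : ℝ) (hε : ε = 1 ∨ ε = -1) (p : EuclideanSpace ℝ (Fin (n+1)))
    (t : ℝ) (ht : 0 ≤ t) :
    μH[(n:ℝ)] {x : EuclideanSpace ℝ (Fin (n+1)) | dist x c = ρ ∧
      ρ ≤ (n+1) * (ε * (x i - c i)) ∧ dist x p ≤ t}
      ≤ ENNReal.ofReal ((((n:ℝ)+1)^3 * 2)^n * t^n) := by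
  set P := {x : EuclideanSpace ℝ (Fin (n+1)) | dist x c = ρ ∧
      ρ ≤ (n+1) * (ε * (x i - c i)) ∧ dist x p ≤ t} with hP
  let f : P → (Fin n → ℝ) := fun x j => (x : EuclideanSpace ℝ (Fin (n+1))) (i.succAbove j)
  let K : ℝ≥0 := ((n:ℝ≥0)+1)^3
  have hf : AntilipschitzWith K f := by
    refine AntilipschitzWith.of_le_mul_dist ?_
    rintro ⟨x, hx⟩ ⟨y, hy⟩
    have := patch_dist n c ρ hρ i ε hε x y hx.1 hy.1 hx.2.1 hy.2.1
      (dist (f ⟨x, hx⟩) (f ⟨y, hy⟩)) (fun j => by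
        have := dist_le_pi_dist (f ⟨x, hx⟩) (f ⟨y, hy⟩) j
        rwa [Real.dist_eq] at this) dist_nonneg
    rw [Subtype.dist_eq]
    simpa [K] using this
  have h1 : μH[(n:ℝ)] (Set.univ : Set P) = μH[(n:ℝ)] P := by
    have := (isometry_subtype_coe (s := P)).hausdorffMeasure_image (d := (n:ℝ))
      (Or.inl (Nat.cast_nonneg n)) Set.univ
    rw [← this]
    simp
  have h2 := hf.le_hausdorffMeasure_image (d := (n:ℝ)) (Nat.cast_nonneg n) Set.univ
  have h3 : f '' Set.univ ⊆ Metric.closedBall (fun j => p (i.succAbove j)) t := by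
    rintro _ ⟨⟨x, hx⟩, -, rfl⟩
    rw [Metric.mem_closedBall, dist_pi_le_iff ht]
    intro j
    refine le_trans ?_ hx.2.2
    rw [dist_eq_norm x p, dist_eq_norm]
    simpa using PiLp.norm_apply_le (x - p) (i.succAbove j)
  have h4 : (μH[(n:ℝ)] : Measure (Fin n → ℝ)) = volume := by
    have := hausdorffMeasure_pi_real (ι := Fin n)
    simpa using this
  rw [← h1]
  refine h2.trans ?_
  rw [h4]
  refine (mul_le_mul_right (measure_mono h3) _).trans ?_
  rw [Real.volume_pi_closedBall _ ht]
  have : (K : ℝ≥0∞) ^ (n:ℝ) = ENNReal.ofReal ((((n:ℝ)+1)^3)^n) := by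
    rw [ENNReal.rpow_natCast, ENNReal.ofReal_pow (by positivity)]
    congr 1
    rw [← ENNReal.ofReal_coe_nnreal]
    simp [K]
  rw [this, ← ENNReal.ofReal_mul (by positivity)]
  apply ENNReal.ofReal_le_ofReal
  simp only [Fintype.card_fin]
  rw [mul_pow, mul_pow, mul_assoc]

lemma sphere_measure (n : ℕ) : ∃ A : ℝ, 0 < A ∧
    ∀ (c : EuclideanSpace ℝ (Fin (n+1))) (ρ : ℝ), 0 < ρ →
    ∀ (p : EuclideanSpace ℝ (Fin (n+1))) (t : ℝ), 0 ≤ t →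
    μH[(n:ℝ)] (Metric.sphere c ρ ∩ Metric.closedBall p t) ≤ ENNReal.ofReal (A * t^n) := by
  refine ⟨((n:ℝ)+1) * (2 * (((n:ℝ)+1)^3 * 2)^n), by positivity, ?_⟩
  intro c ρ hρ p t ht
  let Q : Fin (n+1) → ℝ → Set (EuclideanSpace ℝ (Fin (n+1))) := fun i ε => {x | dist x c = ρ ∧
      ρ ≤ (n+1) * (ε * (x i - c i)) ∧ dist x p ≤ t}
  have hsub : Metric.sphere c ρ ∩ Metric.closedBall p t ⊆ ⋃ i, (Q i 1 ∪ Q i (-1)) := by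
    rintro x ⟨hx, hxt⟩
    rw [Metric.mem_sphere] at hx
    rw [Metric.mem_closedBall] at hxt
    have : ∃ i, ρ ≤ (n+1) * |x i - c i| := by
      by_contra! hcon
      have e1 : ∀ i ∈ (Finset.univ : Finset (Fin (n+1))),
          dist (x i) (c i) ^ 2 < (ρ / (n+1))^2 := by
        intro i _
        rw [Real.dist_eq]
        apply pow_lt_pow_left₀ _ (abs_nonneg _) two_ne_zero
        rw [lt_div_iff₀ (by positivity)]
        linarith [hcon i]
      have e2 := Finset.sum_lt_sum_of_nonempty Finset.univ_nonempty e1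
      have e3 : ∑ i, dist (x i) (c i) ^ 2 = ρ^2 := by
        rw [← hx, EuclideanSpace.dist_eq, Real.sq_sqrt (by positivity)]
      rw [e3] at e2
      simp only [Finset.sum_const, Finset.card_univ, Fintype.card_fin, nsmul_eq_mul] at e2
      push_cast at e2
      have e4 : ((n:ℝ)+1) * (ρ/(n+1))^2 = ρ^2 / (n+1) := by field_simp
      rw [e4] at e2
      have e5 : ρ^2 / ((n:ℝ)+1) ≤ ρ^2 := div_le_self (by positivity)
        (by linarith [(Nat.cast_nonneg n : (0:ℝ) ≤ n)])
      linarith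
    obtain ⟨i, hi⟩ := this
    refine Set.mem_iUnion.2 ⟨i, ?_⟩
    rcases le_total 0 (x i - c i) with h | h
    · left
      rw [abs_of_nonneg h] at hi
      exact ⟨hx, by linarith, hxt⟩
    · right
      rw [abs_of_nonpos h] at hi
      exact ⟨hx, by linarith, hxt⟩
  refine (measure_mono hsub).trans ((measure_iUnion_le _).trans ?_)
  rw [tsum_fintype]
  have : ∀ i ∈ (Finset.univ : Finset (Fin (n+1))), μH[(n:ℝ)] (Q i 1 ∪ Q i (-1)) ≤
      ENNReal.ofReal (2 * ((((n:ℝ)+1)^3 * 2)^n * t^n)) := by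
    intro i _
    refine (measure_union_le _ _).trans ?_
    rw [two_mul, ENNReal.ofReal_add (by positivity) (by positivity)]
    exact add_le_add (patch_measure n c ρ hρ i 1 (Or.inl rfl) p t ht)
      (patch_measure n c ρ hρ i (-1) (Or.inr rfl) p t ht)
  refine (Finset.sum_le_sum this).trans ?_
  simp only [Finset.sum_const, Finset.card_univ, Fintype.card_fin, nsmul_eq_mul]
  rw [← ENNReal.ofReal_natCast, ← ENNReal.ofReal_mul (by positivity)]
  apply ENNReal.ofReal_le_ofReal
  push_cast
  apply le_of_eq
  ring

/-- Dyadic bound of the integrand. -/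
lemma integrand_le (n : ℕ) (q : ℝ) (hq : (n:ℝ)+1 ≤ q) (θ : EuclideanSpace ℝ (Fin (n+1))) :
    ENNReal.ofReal ((1 + ‖θ‖^2) ^ (-q/2)) ≤
      ∑' k : ℕ, (Metric.closedBall (0 : EuclideanSpace ℝ (Fin (n+1))) (2^k)).indicator
        (fun _ => ENNReal.ofReal (2^(n+1) * ((1/2)^k)^(n+1))) θ := by
  have hex : ∃ k : ℕ, ‖θ‖ ≤ 2^k := by
    obtain ⟨k, hk⟩ := pow_unbounded_of_one_lt ‖θ‖ (by norm_num : (1:ℝ) < 2)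
    exact ⟨k, hk.le⟩
  classical
  let k := Nat.find hex
  have hk : ‖θ‖ ≤ 2^k := Nat.find_spec hex
  refine le_trans ?_ (ENNReal.le_tsum k)
  rw [Set.indicator_of_mem (by simpa using hk)]
  apply ENNReal.ofReal_le_ofReal
  have hb : (1:ℝ) ≤ 1 + ‖θ‖^2 := by nlinarith [sq_nonneg ‖θ‖]
  have h1 : (1 + ‖θ‖^2) ^ (-q/2) ≤ (1 + ‖θ‖^2) ^ (-((n:ℝ)+1)/2) :=
    Real.rpow_le_rpow_of_exponent_le hb (by linarith)
  refine h1.trans ?_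
  have h2 : (1 + ‖θ‖^2) ^ (-((n:ℝ)+1)/2) = (√(1 + ‖θ‖^2) ^ (n+1))⁻¹ := by
    rw [Real.sqrt_eq_rpow, ← Real.rpow_natCast _ (n+1),
      ← Real.rpow_mul (by linarith : (0:ℝ) ≤ 1 + ‖θ‖^2),
      ← Real.rpow_neg (by linarith : (0:ℝ) ≤ 1 + ‖θ‖^2)]
    congr 1
    push_cast
    ring
  rw [h2]
  have h3 : (2:ℝ)^k / 2 ≤ √(1 + ‖θ‖^2) := by
    rcases Nat.eq_zero_or_pos k with h | h
    · rw [h]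
      apply Real.le_sqrt_of_sq_le
      norm_num
      nlinarith [sq_nonneg ‖θ‖]
    · have hm := Nat.find_min hex (m := k - 1) (by change k - 1 < k; omega)
      push Not at hm
      have e : (2:ℝ)^k = 2^(k-1) * 2 := by
        rw [← pow_succ]; congr 1; omega
      rw [e]
      apply Real.le_sqrt_of_sq_le
      have : (0:ℝ) < 2^(k-1) := by positivity
      nlinarith
  have h4 : (2:ℝ)^(n+1) * ((1/2)^k)^(n+1) = (((2:ℝ)^k/2)^(n+1))⁻¹ := by
    rw [← mul_pow, ← inv_pow]
    congr 1
    rw [inv_div, one_div, inv_pow]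
    rfl
  rw [h4]
  gcongr

lemma sphere_integral (n : ℕ) : ∃ A : ℝ, 0 < A ∧
    ∀ (q : ℝ), (n:ℝ)+1 ≤ q → ∀ (c : EuclideanSpace ℝ (Fin (n+1))) (ρ : ℝ), 0 < ρ →
    (∫ θ in Metric.sphere c ρ, (1 + ‖θ‖^2) ^ (-q/2) ∂(μH[(n:ℝ)])) ≤ A ∧
    (∫ θ in Metric.sphere c ρ, (1 + ‖θ‖^2) ^ (-q/2) ∂(μH[(n:ℝ)])) ≤ A * ρ^n := by
  obtain ⟨A, hA, hm⟩ := sphere_measure n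
  refine ⟨A * 2^(n+1) * 2, by positivity, ?_⟩
  intro q hq c ρ hρ
  have hcont : Continuous (fun θ : EuclideanSpace ℝ (Fin (n+1)) => (1 + ‖θ‖^2) ^ (-q/2)) := by
    apply Continuous.rpow_const (by fun_prop)
    intro x; left; positivity
  rw [integral_eq_lintegral_of_nonneg_ae (Filter.Eventually.of_forall (fun θ => by
    simp only [Pi.zero_apply]; positivity)) hcont.aestronglyMeasurable]
  constructor
  · apply ENNReal.toReal_le_of_le_ofReal (by positivity)
    refine (lintegral_mono (integrand_le n q hq)).trans ?_
    rw [lintegral_tsum (fun k => (measurable_const.indicator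
      Metric.isClosed_closedBall.measurableSet).aemeasurable)]
    have : ∀ k : ℕ, ∫⁻ θ in Metric.sphere c ρ,
        (Metric.closedBall (0 : EuclideanSpace ℝ (Fin (n+1))) (2^k)).indicator
        (fun _ => ENNReal.ofReal (2^(n+1) * ((1/2)^k)^(n+1))) θ ∂(μH[(n:ℝ)])
        ≤ ENNReal.ofReal (A * 2^(n+1) * (1/2)^k) := by
      intro k
      rw [lintegral_indicator_const Metric.isClosed_closedBall.measurableSet,
        Measure.restrict_apply Metric.isClosed_closedBall.measurableSet, Set.inter_comm]
      refine (mul_le_mul_right (hm c ρ hρ 0 (2^k) (by positivity)) _).trans ?_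
      rw [← ENNReal.ofReal_mul (by positivity)]
      apply ENNReal.ofReal_le_ofReal
      apply le_of_eq
      have : ((1/2:ℝ)^k)^n * ((2:ℝ)^k)^n = 1 := by
        rw [← mul_pow, ← mul_pow]; norm_num
      calc (2:ℝ)^(n+1) * ((1/2)^k)^(n+1) * (A * (2^k)^n)
          = A * 2^(n+1) * (1/2)^k * (((1/2:ℝ)^k)^n * ((2:ℝ)^k)^n) := by ring
        _ = _ := by rw [this, mul_one]
    refine (ENNReal.tsum_le_tsum this).trans ?_
    rw [← ENNReal.ofReal_tsum_of_nonneg (fun k => by positivity)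
      (summable_geometric_two.mul_left _), tsum_mul_left, tsum_geometric_two]
  · apply ENNReal.toReal_le_of_le_ofReal (by positivity)
    have : ∀ θ : EuclideanSpace ℝ (Fin (n+1)),
        ENNReal.ofReal ((1 + ‖θ‖^2) ^ (-q/2)) ≤ 1 := by
      intro θ
      rw [ENNReal.ofReal_le_one]
      apply Real.rpow_le_one_of_one_le_of_nonpos
      · nlinarith [sq_nonneg ‖θ‖]
      · linarith [(Nat.cast_nonneg n : (0:ℝ) ≤ n)]
    refine (lintegral_mono this).trans ?_
    rw [lintegral_one, Measure.restrict_apply_univ]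
    have h := hm c ρ hρ c ρ hρ.le
    rw [Set.inter_eq_left.2 Metric.sphere_subset_closedBall] at h
    refine h.trans (ENNReal.ofReal_le_ofReal ?_)
    apply mul_le_mul_of_nonneg_right _ (by positivity)
    have : (1:ℝ) ≤ 2^(n+1) := one_le_pow₀ (by norm_num)
    nlinarith

lemma KR_bound (N : ℕ) (hN : 2 ≤ N) : ∃ C : ℝ, 0 < C ∧ ∀ s : ℝ, 0 < s → ∀ R : ℝ, 2 ≤ R →
    ∀ r ∈ Set.Ioo (0:ℝ) 1, ∀ r' ∈ Set.Ioi (-R) \ Set.Ioo (-2:ℝ) 2,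
      0 ≤ KR N hN s R r r' ∧ KR N hN s R r r' ≤ C := by
  obtain ⟨n, rfl⟩ : ∃ n, N = n + 1 := ⟨N - 1, by omega⟩
  obtain ⟨A, hA, hI⟩ := sphere_integral n
  refine ⟨8^n * A, by positivity, ?_⟩
  intro s hs R hR r hr r' hr'
  obtain ⟨hr0, hr1⟩ := hr
  obtain ⟨hr'R, hr'2⟩ := hr'
  rw [Set.mem_Ioi] at hr'R
  have ha : 0 < r + R := by linarith
  have hb : 0 < r' + R := by linarith
  have hd : 0 < |r - r'| := by
    rw [abs_pos]
    intro h
    apply hr'2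
    constructor <;> linarith
  have hab : 0 < (r + R) * (r' + R) := mul_pos ha hb
  have hρ : 0 < √((r + R) * (r' + R)) / |r - r'| := by positivity
  unfold KR
  have e1 : (((n+1:ℕ):ℝ) - 1) = (n:ℝ) := by push_cast; ring
  rw [e1]
  have hpow : ((r + R) * (r' + R)) ^ ((n:ℝ)/2) = √((r + R) * (r' + R)) ^ n := by
    rw [Real.sqrt_eq_rpow, ← Real.rpow_natCast _ n, ← Real.rpow_mul hab.le]
    congr 1; ring
  have hRn : R ^ (-(n:ℝ)) = (R^n)⁻¹ := by
    rw [Real.rpow_neg (by linarith), Real.rpow_natCast]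
  rw [hpow, hRn]
  obtain ⟨I1, I2⟩ := hI (((n+1:ℕ):ℝ) + 2 * s) (by push_cast; linarith)
    (-((√((r + R) * (r' + R)) / |r - r'|) •
          EuclideanSpace.single (⟨0, by omega⟩ : Fin (n+1)) (1:ℝ))) _ hρ
  have I0 : 0 ≤ ∫ θ in Metric.sphere (-((√((r + R) * (r' + R)) / |r - r'|) •
          EuclideanSpace.single (⟨0, by omega⟩ : Fin (n+1)) (1:ℝ)))
          (√((r + R) * (r' + R)) / |r - r'|),
          (1 + ‖θ‖^2) ^ (-(((n+1:ℕ):ℝ) + 2 * s)/2) ∂(μH[(n:ℝ)]) :=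
    integral_nonneg (fun θ => by positivity)
  have hR0 : 0 < R := by linarith
  refine ⟨by positivity, ?_⟩
  have hsq := Real.sq_sqrt hab.le
  rcases le_or_gt r' R with h | h
  · have e2 : √((r + R) * (r' + R)) ≤ 8 * R := by
      apply Real.sqrt_le_iff.2 ⟨by positivity, ?_⟩
      nlinarith
    calc _ ≤ (8 * R)^n * (R^n)⁻¹ * A := by gcongr
      _ = 8^n * A := by rw [mul_pow]; field_simp
  · have e3 : |r - r'| = r' - r := by rw [abs_of_neg (by linarith)]; ring
    have e4 : √((r + R) * (r' + R)) * (√((r + R) * (r' + R)) / |r - r'|) ≤ 8 * R := by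
      rw [← mul_div_assoc, ← sq, hsq, div_le_iff₀ hd, e3]
      have f1 : r + R ≤ 2 * R := by linarith
      have f2 : r' + R ≤ 2 * r' := by linarith
      have f3 : r' ≤ 2 * (r' - r) := by linarith
      calc (r + R) * (r' + R) ≤ (2 * R) * (2 * r') := by gcongr
        _ ≤ (2 * R) * (2 * (2 * (r' - r))) := by gcongr
        _ = 8 * R * (r' - r) := by ring
    calc _ ≤ √((r + R) * (r' + R))^n * (R^n)⁻¹ *
            (A * (√((r + R) * (r' + R)) / |r - r'|)^n) := by gcongr
      _ = (√((r + R) * (r' + R)) * (√((r + R) * (r' + R)) / |r - r'|))^n * (R^n)⁻¹ * A := by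
          rw [mul_pow]; ring
      _ ≤ (8 * R)^n * (R^n)⁻¹ * A := by gcongr
      _ = 8^n * A := by rw [mul_pow]; field_simp

theorem stmt19 (N : ℕ) (hN : 2 ≤ N) (s : ℝ) (hs : s ∈ Set.Ioo (0:ℝ) 1) :
    ∃ C > 0, ∃ R₀ > 1, ∀ R : ℝ, R₀ ≤ R → ∀ r ∈ Set.Ioo (0:ℝ) 1,
      (∫ r' in Set.Ioi (-R) \ Set.Ioo (-2:ℝ) 2,
        KR N hN s R r r' / |r - r'| ^ (1 + 2*s)) ≤ C := by
  obtain ⟨K, hK, hb⟩ := KR_bound N hN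
  have hs0 := hs.1
  let g : ℝ → ℝ := fun x => K * 3^(1+2*s) * (1 + ‖x‖) ^ (-(1+2*s))
  have hg : Integrable g := by
    apply Integrable.const_mul
    apply integrable_one_add_norm
    simp
    linarith
  have hg0 : ∀ x, 0 ≤ g x := fun x => by positivity
  refine ⟨(∫ x, g x) + 1, by have : 0 ≤ ∫ x, g x := integral_nonneg hg0; positivity, 2, by norm_num, ?_⟩
  intro R hR r hr
  have hmeas : MeasurableSet (Set.Ioi (-R) \ Set.Ioo (-2:ℝ) 2) :=
    measurableSet_Ioi.diff measurableSet_Ioo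
  have h1 : (∫ r' in Set.Ioi (-R) \ Set.Ioo (-2:ℝ) 2,
        KR N hN s R r r' / |r - r'| ^ (1 + 2*s)) ≤
      ∫ r' in Set.Ioi (-R) \ Set.Ioo (-2:ℝ) 2, g r' := by
    apply integral_mono_of_nonneg
    · filter_upwards [ae_restrict_mem hmeas] with x hx
      have := (hb s hs0 R hR r hr x hx).1
      simp only [Pi.zero_apply]
      positivity
    · exact hg.integrableOn
    · filter_upwards [ae_restrict_mem hmeas] with x hx
      have hk := (hb s hs0 R hR r hr x hx).2
      have h3 : (1 + ‖x‖) / 3 ≤ |r - x| := by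
        rw [Real.norm_eq_abs]
        have hx2 := hx.2
        rw [Set.mem_Ioo, not_and_or, not_lt, not_lt] at hx2
        rcases hx2 with h | h
        · rw [abs_of_neg (by linarith : x < 0), abs_of_pos (by linarith [hr.1])]
          linarith [hr.1]
        · rw [abs_of_pos (by linarith : 0 < x), abs_of_neg (by linarith [hr.2])]
          linarith [hr.2]
      have hp : 0 < (1 + ‖x‖) / 3 := by positivity
      calc KR N hN s R r x / |r - x| ^ (1 + 2*s) ≤ K / ((1 + ‖x‖) / 3) ^ (1+2*s) := by
            gcongr
        _ = g x := by
            simp only [g]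
            rw [Real.div_rpow (by positivity) (by norm_num), Real.rpow_neg (by positivity)]
            field_simp
  have h2 : ∫ r' in Set.Ioi (-R) \ Set.Ioo (-2:ℝ) 2, g r' ≤ ∫ x, g x :=
    setIntegral_le_integral hg (Filter.Eventually.of_forall hg0)
  linarith
end
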